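/- (Concavity of coherent information for degradable channels.) Let V be a complex matrix with columns indexed by Fin a and rows indexed by Fin b × Fin e, satisfying VᴴV = I_a (an isometry from ℂ^a into ℂ^b ⊗ ℂ^e). For a density matrix ρ on ℂ^a define the channel output N(ρ) = Tr_E(V ρ Vᴴ) (a density matrix on ℂ^b) and the complementary output N_c(ρ) = Tr_B(V ρ Vᴴ) (a density matrix on ℂ^e), where Tr_E and Tr_B are the partial traces over the second and first tensor factor of ℂ^b ⊗ ℂ^e respectively. Suppose N is degradable: there exist finitely many e×b complex matrices K₁,…,K_m with ∑ᵢ Kᵢᴴ Kᵢ = I_b such that N_c(ρ) = ∑ᵢ Kᵢ N(ρ) Kᵢᴴ for every density matrix ρ on ℂ^a. Define I_c(ρ, N) = H(N(ρ)) − H(N_c(ρ)). Then I_c(·, N) is concave on density matrices: for all density matrices ρ₀, ρ₁ on ℂ^a and all λ ∈ [0,1], λ·I_c(ρ₀, N) + (1−λ)·I_c(ρ₁, N) ≤ I_c(λρ₀ + (1−λ)ρ₁, N). -/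

import Mathlib

open Matrix ComplexOrder

/-- The von Neumann entropy (base-2) of a matrix, via its eigenvalues. -/
noncomputable def vnEntropy {n : Type*} [Fintype n] [DecidableEq n]
    (ρ : Matrix n n ℂ) : ℝ :=
  if h : ρ.IsHermitian then
    -∑ i, (h.eigenvalues i) * Real.logb 2 (h.eigenvalues i)
  else 0

/-- Partial trace over the second tensor factor. -/
noncomputable def ptraceSnd {a b : Type*} [Fintype b]
    (M : Matrix (a × b) (a × b) ℂ) : Matrix a a ℂ :=
  Matrix.of fun i i' => ∑ j, M (i, j) (i', j)

/-- Partial trace over the first tensor factor. -/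
noncomputable def ptraceFst {a b : Type*} [Fintype a]
    (M : Matrix (a × b) (a × b) ℂ) : Matrix b b ℂ :=
  Matrix.of fun j j' => ∑ i, M (i, j) (i, j')

open Filter Topology in
theorem tendsto_sum_mul_log_add_sub {ι : Type*} [Fintype ι] (w p q : ι → ℝ)
    (hp : ∀ k, 0 ≤ p k) :
    Tendsto (fun T => ∑ k, w k * p k * Real.log (q k + T * p k) - (∑ k, w k * p k) * Real.log T)
      atTop (𝓝 (∑ k, w k * p k * Real.log (p k))) := by
  simp_rw [Finset.sum_mul, ← Finset.sum_sub_distrib]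
  refine tendsto_finsetSum _ fun k _ => ?_
  rcases (hp k).eq_or_lt with h | h
  · simp [← h]
  have hlim : Tendsto (fun T : ℝ => q k / T + p k) atTop (𝓝 (p k)) := by
    simpa using (tendsto_const_nhds.div_atTop tendsto_id).add_const (p k)
  refine ((hlim.log h.ne').const_mul (w k * p k)).congr' ?_
  filter_upwards [eventually_gt_atTop 0, hlim.eventually (lt_mem_nhds h)] with T hT hpos
  rw [← mul_sub, ← Real.log_div _ hT.ne']
  · congr 2
    field_simp
  · have : q k + T * p k = (q k / T + p k) * T := by field_simp
    rw [this]
    positivity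

theorem continuousOn_sum_mul_log_add {ι : Type*} [Fintype ι] (w p q : ι → ℝ)
    (hp : ∀ k, 0 ≤ p k) (hq : ∀ k, 0 ≤ q k) (h0 : ∀ k, q k = 0 → w k * p k = 0) :
    ContinuousOn (fun T => ∑ k, w k * p k * Real.log (q k + T * p k)) (Set.Ici 0) := by
  refine continuousOn_finsetSum _ fun k _ => ?_
  rcases (hq k).eq_or_lt with h | h
  · simpa [h0 k h.symm] using continuousOn_const
  · refine continuousOn_const.mul (ContinuousOn.log (by fun_prop) fun T hT => ?_)
    have := mul_nonneg (Set.mem_Ici.1 hT) (hp k)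
    positivity

theorem hasDerivAt_sum_mul_log_add {ι : Type*} [Fintype ι] (w p q : ι → ℝ)
    (hp : ∀ k, 0 ≤ p k) (hq : ∀ k, 0 ≤ q k) {T : ℝ} (hT : 0 < T) :
    HasDerivAt (fun T => ∑ k, w k * p k * Real.log (q k + T * p k))
      (∑ k, w k * (p k ^ 2 / (q k + T * p k))) T := by
  refine HasDerivAt.fun_sum fun k _ => ?_
  rcases (hp k).eq_or_lt with h | h
  · simpa [← h] using hasDerivAt_const T (0 : ℝ)
  · have hpos : 0 < q k + T * p k := add_pos_of_nonneg_of_pos (hq k) (mul_pos hT h)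
    have h1 : HasDerivAt (fun T => q k + T * p k) (p k) T := by
      simpa using ((hasDerivAt_id T).mul_const (p k)).const_add (q k)
    have h2 := (h1.log hpos.ne').const_mul (w k * p k)
    rwa [show w k * p k * (p k / (q k + T * p k)) = w k * (p k ^ 2 / (q k + T * p k)) by ring]
      at h2

open Filter Topology in
theorem sum_mul_log_sub_le_of_sum_div_le {ι κ : Type*} [Fintype ι] [Fintype κ]
    (w p q : ι → ℝ) (w' p' q' : κ → ℝ)
    (hp : ∀ k, 0 ≤ p k) (hq : ∀ k, 0 ≤ q k) (hp' : ∀ k, 0 ≤ p' k) (hq' : ∀ k, 0 ≤ q' k)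
    (h0 : ∀ k, q k = 0 → w k * p k = 0) (h0' : ∀ k, q' k = 0 → w' k * p' k = 0)
    (hsum : ∑ k, w k * p k = ∑ k, w' k * p' k)
    (hle : ∀ T : ℝ, 0 < T → ∑ k, w' k * (p' k ^ 2 / (q' k + T * p' k)) ≤
      ∑ k, w k * (p k ^ 2 / (q k + T * p k))) :
    ∑ k, w' k * p' k * Real.log (p' k) - ∑ k, w' k * p' k * Real.log (q' k) ≤
      ∑ k, w k * p k * Real.log (p k) - ∑ k, w k * p k * Real.log (q k) := by
  set F : ℝ → ℝ := fun T => ∑ k, w k * p k * Real.log (q k + T * p k) -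
    ∑ k, w' k * p' k * Real.log (q' k + T * p' k) with hF
  have hmono : MonotoneOn F (Set.Ici 0) := by
    refine monotoneOn_of_hasDerivWithinAt_nonneg (convex_Ici 0)
      ((continuousOn_sum_mul_log_add w p q hp hq h0).sub
        (continuousOn_sum_mul_log_add w' p' q' hp' hq' h0'))
      (f' := fun T => ∑ k, w k * (p k ^ 2 / (q k + T * p k)) -
        ∑ k, w' k * (p' k ^ 2 / (q' k + T * p' k))) (fun T hT => ?_) fun T hT => ?_
    all_goals rw [interior_Ici, Set.mem_Ioi] at hT
    · exact ((hasDerivAt_sum_mul_log_add w p q hp hq hT).sub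
        (hasDerivAt_sum_mul_log_add w' p' q' hp' hq' hT)).hasDerivWithinAt
    · exact sub_nonneg.2 (hle T hT)
  have hlim : Tendsto F atTop
      (𝓝 (∑ k, w k * p k * Real.log (p k) - ∑ k, w' k * p' k * Real.log (p' k))) := by
    refine ((tendsto_sum_mul_log_add_sub w p q hp).sub
      (tendsto_sum_mul_log_add_sub w' p' q' hp')).congr fun T => ?_
    rw [hsum, hF]
    ring
  have hle0 := ge_of_tendsto hlim ((eventually_ge_atTop 0).mono fun T hT =>
    hmono Set.self_mem_Ici hT hT)
  simp only [hF, zero_mul, add_zero] at hle0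
  linarith

namespace Matrix

variable {m n ι : Type*} [Fintype m] [Fintype n] [Fintype ι]

/-- The concave quadratic functional whose supremum over `X` is
`∑ i j, |⟪v j, u i⟫|² pᵢ² / (qⱼ + T pᵢ)` for spectral decompositions `ρ = ∑ pᵢ |uᵢ⟩⟨uᵢ|` and
`σ = ∑ qⱼ |vⱼ⟩⟨vⱼ|`. -/
noncomputable def relQuad (ρ σ : Matrix n n ℂ) (T : ℝ) (X : Matrix n n ℂ) : ℝ :=
  2 * (Xᴴ * ρ).trace.re - (X * Xᴴ * σ).trace.re - T * (Xᴴ * X * ρ).trace.re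

open scoped MatrixOrder Matrix.Norms.L2Operator in
theorem re_trace_mul_nonneg {A B : Matrix n n ℂ} (hA : A.PosSemidef) (hB : B.PosSemidef) :
    0 ≤ (A * B).trace.re := by
  classical
  obtain ⟨C, rfl⟩ := CStarAlgebra.nonneg_iff_eq_star_mul_self.mp hA.nonneg
  rw [star_eq_conjTranspose, Matrix.mul_assoc, trace_mul_comm]
  exact (Complex.le_def.1 (hB.mul_mul_conjTranspose_same C).trace_nonneg).1

/-- The Kadison-Schwarz inequality for a unital map given by Kraus operators. -/
theorem posSemidef_sum_conjTranspose_mul_mul_sub [DecidableEq n] (K : ι → Matrix m n ℂ)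
    (hK : ∑ k, (K k)ᴴ * K k = 1) (Y : Matrix m m ℂ) :
    (∑ k, (K k)ᴴ * (Yᴴ * Y) * K k -
      (∑ k, (K k)ᴴ * Y * K k)ᴴ * ∑ k, (K k)ᴴ * Y * K k).PosSemidef := by
  set X := ∑ k, (K k)ᴴ * Y * K k with hX
  have hXH : Xᴴ = ∑ k, (K k)ᴴ * Yᴴ * K k := by
    simp [hX, conjTranspose_sum, Matrix.mul_assoc]
  have key : ∑ k, (K k)ᴴ * (Yᴴ * Y) * K k - Xᴴ * X =
      ∑ k, (Y * K k - K k * X)ᴴ * (Y * K k - K k * X) := by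
    have h1 : ∀ k, (Y * K k - K k * X)ᴴ * (Y * K k - K k * X) =
        (K k)ᴴ * (Yᴴ * Y) * K k - (K k)ᴴ * Yᴴ * K k * X - Xᴴ * ((K k)ᴴ * Y * K k)
          + Xᴴ * ((K k)ᴴ * K k) * X := by
      intro k
      simp only [conjTranspose_sub, conjTranspose_mul, Matrix.mul_sub, Matrix.sub_mul, Matrix.mul_assoc]
      abel
    simp_rw [h1]
    rw [Finset.sum_add_distrib, Finset.sum_sub_distrib, Finset.sum_sub_distrib, ← Matrix.sum_mul,
      ← Matrix.mul_sum, ← Matrix.sum_mul, ← Matrix.mul_sum, hK, ← hXH, ← hX]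
    simp
  rw [key]
  exact posSemidef_sum _ fun k _ => posSemidef_conjTranspose_mul_self _

theorem trace_mul_sum_kraus (K : ι → Matrix m n ℂ) (A : Matrix m m ℂ) (B : Matrix n n ℂ) :
    (A * ∑ k, K k * B * (K k)ᴴ).trace = ((∑ k, (K k)ᴴ * A * K k) * B).trace := by
  rw [Matrix.mul_sum, Matrix.sum_mul, trace_sum, trace_sum]
  refine Finset.sum_congr rfl fun k _ => ?_
  rw [← Matrix.mul_assoc, trace_mul_comm]
  simp only [Matrix.mul_assoc]

theorem trace_sum_kraus [DecidableEq n] (K : ι → Matrix m n ℂ)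
    (hK : ∑ k, (K k)ᴴ * K k = 1) (B : Matrix n n ℂ) :
    (∑ k, K k * B * (K k)ᴴ).trace = B.trace := by
  classical
  simpa [hK] using trace_mul_sum_kraus K 1 B

theorem PosSemidef.sum_kraus {B : Matrix n n ℂ} (hB : B.PosSemidef) (K : ι → Matrix m n ℂ) :
    (∑ k, K k * B * (K k)ᴴ).PosSemidef :=
  posSemidef_sum _ fun k _ => hB.mul_mul_conjTranspose_same (K k)

theorem relQuad_sum_kraus_le [DecidableEq n] (K : ι → Matrix m n ℂ)
    (hK : ∑ k, (K k)ᴴ * K k = 1) {ρ σ : Matrix n n ℂ} (hρ : ρ.PosSemidef) (hσ : σ.PosSemidef)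
    {T : ℝ} (hT : 0 ≤ T) (Y : Matrix m m ℂ) :
    relQuad (∑ k, K k * ρ * (K k)ᴴ) (∑ k, K k * σ * (K k)ᴴ) T Y ≤
      relQuad ρ σ T (∑ k, (K k)ᴴ * Y * K k) := by
  have hXH : (∑ k, (K k)ᴴ * Y * K k)ᴴ = ∑ k, (K k)ᴴ * Yᴴ * K k := by
    simp [conjTranspose_sum, Matrix.mul_assoc]
  have h1 := re_trace_mul_nonneg (posSemidef_sum_conjTranspose_mul_mul_sub K hK Y) hρ
  have h2 := re_trace_mul_nonneg (posSemidef_sum_conjTranspose_mul_mul_sub K hK Yᴴ) hσ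
  rw [← hXH, conjTranspose_conjTranspose, conjTranspose_conjTranspose] at h2
  rw [Matrix.sub_mul, trace_sub, Complex.sub_re, ← trace_mul_sum_kraus] at h1 h2
  unfold relQuad
  rw [trace_mul_sum_kraus K Yᴴ, ← hXH]
  nlinarith

section Spectral

variable [DecidableEq n] {ρ σ : Matrix n n ℂ}

theorem relQuad_eq_sum (hρ : ρ.IsHermitian) (hσ : σ.IsHermitian) (T : ℝ) (Z : Matrix n n ℂ) :
    relQuad ρ σ T (hσ.eigenvectorUnitary * Z * (hρ.eigenvectorUnitary : Matrix n n ℂ)ᴴ) =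
      ∑ x : n × n, (2 * hρ.eigenvalues x.1 * (star (Z x.2 x.1) *
        ((hσ.eigenvectorUnitary : Matrix n n ℂ)ᴴ * hρ.eigenvectorUnitary) x.2 x.1).re -
        (hσ.eigenvalues x.2 + T * hρ.eigenvalues x.1) * Complex.normSq (Z x.2 x.1)) := by
  have eρ := hρ.spectral_theorem
  have eσ := hσ.spectral_theorem
  rw [Unitary.conjStarAlgAut_apply, star_eq_conjTranspose] at eρ eσ
  have hU : (hρ.eigenvectorUnitary : Matrix n n ℂ)ᴴ * hρ.eigenvectorUnitary = 1 :=
    Unitary.coe_star_mul_self _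
  have hW : (hσ.eigenvectorUnitary : Matrix n n ℂ)ᴴ * hσ.eigenvectorUnitary = 1 :=
    Unitary.coe_star_mul_self _
  generalize (hρ.eigenvectorUnitary : Matrix n n ℂ) = U at *
  generalize (hσ.eigenvectorUnitary : Matrix n n ℂ) = W at *
  generalize hρ.eigenvalues = p at *
  generalize hσ.eigenvalues = q at *
  have cancelU : ∀ A : Matrix n n ℂ, Uᴴ * (U * A) = A := fun A => by
    rw [← Matrix.mul_assoc, hU, Matrix.one_mul]
  have cancelW : ∀ A : Matrix n n ℂ, Wᴴ * (W * A) = A := fun A => by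
    rw [← Matrix.mul_assoc, hW, Matrix.one_mul]
  have h1 : ((W * Z * Uᴴ)ᴴ * ρ).trace =
      (Zᴴ * (Wᴴ * U * diagonal (RCLike.ofReal ∘ p))).trace := by
    rw [eρ]
    simp only [conjTranspose_mul, conjTranspose_conjTranspose, Matrix.mul_assoc]
    rw [trace_mul_comm]
    simp only [Matrix.mul_assoc, hU, Matrix.mul_one]
  have h2 : ((W * Z * Uᴴ) * (W * Z * Uᴴ)ᴴ * σ).trace =
      (Zᴴ * (diagonal (RCLike.ofReal ∘ q) * Z)).trace := by
    rw [eσ]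
    simp only [conjTranspose_mul, conjTranspose_conjTranspose, Matrix.mul_assoc, cancelU, cancelW]
    rw [trace_mul_comm]
    simp only [Matrix.mul_assoc, hW, Matrix.mul_one]
    rw [trace_mul_comm]
    simp only [Matrix.mul_assoc]
  have h3 : ((W * Z * Uᴴ)ᴴ * (W * Z * Uᴴ) * ρ).trace =
      (Zᴴ * (Z * diagonal (RCLike.ofReal ∘ p))).trace := by
    rw [eρ]
    simp only [conjTranspose_mul, conjTranspose_conjTranspose, Matrix.mul_assoc, cancelU, cancelW]
    rw [trace_mul_comm]
    simp only [Matrix.mul_assoc, hU, Matrix.mul_one]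
  unfold relQuad
  rw [h1, h2, h3]
  generalize Wᴴ * U = M
  simp only [trace, diag_apply, mul_apply (M := Zᴴ), mul_diagonal, diagonal_mul, conjTranspose_apply,
    Complex.re_sum, Finset.mul_sum, ← Finset.sum_sub_distrib, Fintype.sum_prod_type]
  refine Finset.sum_congr rfl fun i _ => Finset.sum_congr rfl fun j _ => ?_
  simp [Complex.normSq_apply]
  ring

/-- The squared overlaps of the eigenvectors of two Hermitian matrices. -/
noncomputable def eigenOverlap (hρ : ρ.IsHermitian) (hσ : σ.IsHermitian) (x : n × n) : ℝ :=
  Complex.normSq (((hσ.eigenvectorUnitary : Matrix n n ℂ)ᴴ * hρ.eigenvectorUnitary) x.2 x.1)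

theorem relQuad_le (hρ : ρ.PosSemidef) (hσ : σ.PosSemidef) {T : ℝ} (hT : 0 < T)
    (X : Matrix n n ℂ) :
    relQuad ρ σ T X ≤ ∑ x : n × n, eigenOverlap hρ.1 hσ.1 x *
      (hρ.1.eigenvalues x.1 ^ 2 / (hσ.1.eigenvalues x.2 + T * hρ.1.eigenvalues x.1)) := by
  have hX : X = hσ.1.eigenvectorUnitary *
      ((hσ.1.eigenvectorUnitary : Matrix n n ℂ)ᴴ * X * hρ.1.eigenvectorUnitary) *
        (hρ.1.eigenvectorUnitary : Matrix n n ℂ)ᴴ := by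
    have h1 : (hρ.1.eigenvectorUnitary : Matrix n n ℂ) * (hρ.1.eigenvectorUnitary : Matrix n n ℂ)ᴴ
      = 1 := Unitary.coe_mul_star_self _
    have h2 : (hσ.1.eigenvectorUnitary : Matrix n n ℂ) * (hσ.1.eigenvectorUnitary : Matrix n n ℂ)ᴴ
      = 1 := Unitary.coe_mul_star_self _
    rw [Matrix.mul_assoc, Matrix.mul_assoc, h1, ← Matrix.mul_assoc, ← Matrix.mul_assoc, h2]
    simp
  rw [hX, relQuad_eq_sum]
  refine Finset.sum_le_sum fun x _ => ?_
  unfold eigenOverlap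
  generalize ((hσ.1.eigenvectorUnitary : Matrix n n ℂ)ᴴ * X * hρ.1.eigenvectorUnitary) x.2 x.1 = z
  generalize ((hσ.1.eigenvectorUnitary : Matrix n n ℂ)ᴴ * hρ.1.eigenvectorUnitary) x.2 x.1 = u
  have hp := hρ.eigenvalues_nonneg x.1
  have hq := hσ.eigenvalues_nonneg x.2
  generalize hρ.1.eigenvalues x.1 = p at *
  generalize hσ.1.eigenvalues x.2 = q at *
  rcases hp.eq_or_lt with rfl | hp'
  · simpa using mul_nonneg hq (Complex.normSq_nonneg z)
  have hc : 0 < q + T * p := by positivity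
  generalize q + T * p = c at *
  rw [← mul_div_assoc, le_div_iff₀ hc]
  simp only [Complex.normSq_apply, Complex.star_def, Complex.mul_re, Complex.conj_re,
    Complex.conj_im]
  nlinarith [sq_nonneg (c * z.re - p * u.re), sq_nonneg (c * z.im - p * u.im)]

theorem exists_relQuad_eq (hρ : ρ.PosSemidef) (hσ : σ.PosSemidef) {T : ℝ} (hT : 0 < T) :
    ∃ X, relQuad ρ σ T X = ∑ x : n × n, eigenOverlap hρ.1 hσ.1 x *
      (hρ.1.eigenvalues x.1 ^ 2 / (hσ.1.eigenvalues x.2 + T * hρ.1.eigenvalues x.1)) := by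
  refine ⟨hσ.1.eigenvectorUnitary * (Matrix.of fun j i =>
    ((hρ.1.eigenvalues i / (hσ.1.eigenvalues j + T * hρ.1.eigenvalues i) : ℝ) : ℂ) *
      ((hσ.1.eigenvectorUnitary : Matrix n n ℂ)ᴴ * hρ.1.eigenvectorUnitary) j i) *
        (hρ.1.eigenvectorUnitary : Matrix n n ℂ)ᴴ, ?_⟩
  rw [relQuad_eq_sum]
  refine Finset.sum_congr rfl fun x _ => ?_
  unfold eigenOverlap
  rw [of_apply]
  generalize ((hσ.1.eigenvectorUnitary : Matrix n n ℂ)ᴴ * hρ.1.eigenvectorUnitary) x.2 x.1 = u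
  have hp := hρ.eigenvalues_nonneg x.1
  have hq := hσ.eigenvalues_nonneg x.2
  generalize hρ.1.eigenvalues x.1 = p at *
  generalize hσ.1.eigenvalues x.2 = q at *
  rcases hp.eq_or_lt with rfl | hp'
  · simp
  have hc : 0 < q + T * p := by positivity
  generalize q + T * p = c at *
  simp only [Complex.normSq_apply, Complex.star_def, Complex.mul_re, Complex.conj_re,
    Complex.conj_im, Complex.mul_im, Complex.ofReal_re, Complex.ofReal_im]
  field_simp
  ring

/-- The trace of `ρ * log σ`, computed in an eigenbasis of `σ`. -/
noncomputable def traceMulLog (hσ : σ.IsHermitian) (ρ : Matrix n n ℂ) : ℝ :=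
  ∑ j, (((hσ.eigenvectorUnitary : Matrix n n ℂ)ᴴ * ρ * hσ.eigenvectorUnitary) j j).re *
    Real.log (hσ.eigenvalues j)

theorem traceMulLog_add_smul (hσ : σ.IsHermitian) (a b : ℝ) (ρ₀ ρ₁ : Matrix n n ℂ) :
    traceMulLog hσ ((a : ℂ) • ρ₀ + (b : ℂ) • ρ₁) =
      a * traceMulLog hσ ρ₀ + b * traceMulLog hσ ρ₁ := by
  simp only [traceMulLog, Finset.mul_sum, ← Finset.sum_add_distrib]
  refine Finset.sum_congr rfl fun j _ => ?_
  simp [Matrix.mul_add, Matrix.add_mul]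
  ring

theorem conjTranspose_eigenvectorUnitary_mul_mul (hσ : σ.IsHermitian) :
    (hσ.eigenvectorUnitary : Matrix n n ℂ)ᴴ * σ * (hσ.eigenvectorUnitary : Matrix n n ℂ) =
      diagonal (RCLike.ofReal ∘ hσ.eigenvalues) := by
  have h := hσ.conjStarAlgAut_star_eigenvectorUnitary
  simpa [Unitary.conjStarAlgAut_apply, star_eq_conjTranspose] using h

theorem traceMulLog_self (hσ : σ.IsHermitian) :
    traceMulLog hσ σ = ∑ j, hσ.eigenvalues j * Real.log (hσ.eigenvalues j) := by
  simp [traceMulLog, conjTranspose_eigenvectorUnitary_mul_mul]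

theorem re_conj_eigenvectorUnitary_diag (hρ : ρ.IsHermitian) (hσ : σ.IsHermitian) (j : n) :
    (((hσ.eigenvectorUnitary : Matrix n n ℂ)ᴴ * ρ * hσ.eigenvectorUnitary) j j).re =
      ∑ i, eigenOverlap hρ hσ (i, j) * hρ.eigenvalues i := by
  have eρ := hρ.spectral_theorem
  rw [Unitary.conjStarAlgAut_apply, star_eq_conjTranspose] at eρ
  unfold eigenOverlap
  generalize (hσ.eigenvectorUnitary : Matrix n n ℂ) = W at *
  generalize (hρ.eigenvectorUnitary : Matrix n n ℂ) = U at *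
  generalize hρ.eigenvalues = p at *
  have h : Wᴴ * ρ * W = (Wᴴ * U) * diagonal (RCLike.ofReal ∘ p) * (Wᴴ * U)ᴴ := by
    simp only [eρ, conjTranspose_mul, conjTranspose_conjTranspose, Matrix.mul_assoc]
  rw [h, Matrix.mul_apply, Complex.re_sum]
  refine Finset.sum_congr rfl fun i _ => ?_
  simp [mul_diagonal, Complex.normSq_apply]
  ring

theorem traceMulLog_eq_sum (hρ : ρ.IsHermitian) (hσ : σ.IsHermitian) :
    traceMulLog hσ ρ = ∑ x : n × n, eigenOverlap hρ hσ x * hρ.eigenvalues x.1 *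
      Real.log (hσ.eigenvalues x.2) := by
  simp only [traceMulLog, re_conj_eigenvectorUnitary_diag hρ hσ, Finset.sum_mul]
  rw [Fintype.sum_prod_type_right]

theorem sum_eigenOverlap (hρ : ρ.IsHermitian) (hσ : σ.IsHermitian) (i : n) :
    ∑ j, eigenOverlap hρ hσ (i, j) = 1 := by
  unfold eigenOverlap
  have hU : (hρ.eigenvectorUnitary : Matrix n n ℂ)ᴴ * hρ.eigenvectorUnitary = 1 :=
    Unitary.coe_star_mul_self _
  have hW : (hσ.eigenvectorUnitary : Matrix n n ℂ) * (hσ.eigenvectorUnitary : Matrix n n ℂ)ᴴ = 1 :=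
    Unitary.coe_mul_star_self _
  generalize (hσ.eigenvectorUnitary : Matrix n n ℂ) = W at *
  generalize (hρ.eigenvectorUnitary : Matrix n n ℂ) = U at *
  have h : (Wᴴ * U)ᴴ * (Wᴴ * U) = 1 := by
    rw [conjTranspose_mul, conjTranspose_conjTranspose, Matrix.mul_assoc, ← Matrix.mul_assoc W,
      hW, Matrix.one_mul, hU]
  have h' := congrArg Complex.re (congrFun (congrFun h i) i)
  rw [Matrix.mul_apply, Complex.re_sum] at h'
  simpa [Complex.normSq_apply] using h'

theorem sum_eigenOverlap_mul (hρ : ρ.IsHermitian) (hσ : σ.IsHermitian) (f : n → ℝ) :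
    ∑ x : n × n, eigenOverlap hρ hσ x * f x.1 = ∑ i, f i := by
  rw [Fintype.sum_prod_type]
  exact Finset.sum_congr rfl fun i _ => by
    simp only [← Finset.sum_mul, sum_eigenOverlap, one_mul]

theorem eigenOverlap_mul_eq_zero (hρ : ρ.PosSemidef) (hσ : σ.IsHermitian) {c : ℝ} (hc : 0 < c)
    (h : (σ - (c : ℂ) • ρ).PosSemidef) (x : n × n) (hx : hσ.eigenvalues x.2 = 0) :
    eigenOverlap hρ.1 hσ x * hρ.1.eigenvalues x.1 = 0 := by
  have h1 := (Complex.le_def.1 ((h.conjTranspose_mul_mul_same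
    (hσ.eigenvectorUnitary : Matrix n n ℂ)).diag_nonneg (i := x.2))).1
  rw [Matrix.mul_sub, Matrix.sub_mul, conjTranspose_eigenvectorUnitary_mul_mul, Matrix.mul_smul,
    Matrix.smul_mul, sub_apply, smul_apply, diagonal_apply_eq, smul_eq_mul, Complex.sub_re,
    Complex.re_ofReal_mul, re_conj_eigenvectorUnitary_diag hρ.1 hσ] at h1
  have h2 : ∀ i ∈ Finset.univ, 0 ≤ eigenOverlap hρ.1 hσ (i, x.2) * hρ.1.eigenvalues i :=
    fun i _ => mul_nonneg (Complex.normSq_nonneg _) (hρ.eigenvalues_nonneg i)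
  have h3 : ∑ i, eigenOverlap hρ.1 hσ (i, x.2) * hρ.1.eigenvalues i = 0 := by
    refine le_antisymm ?_ (Finset.sum_nonneg h2)
    simp only [Function.comp_apply, hx, RCLike.ofReal_zero, Complex.zero_re] at h1
    nlinarith
  exact (Finset.sum_eq_zero_iff_of_nonneg h2).1 h3 x.1 (Finset.mem_univ _)

theorem sum_eigenvalues_eq_re_trace (hρ : ρ.IsHermitian) :
    ∑ i, hρ.eigenvalues i = ρ.trace.re := by
  rw [hρ.trace_eq_sum_eigenvalues]
  simp

/-- **Data processing inequality**: the relative entropy does not increase under a channel. -/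
theorem traceMulLog_sub_sum_kraus_le [DecidableEq m] (K : ι → Matrix m n ℂ)
    (hK : ∑ k, (K k)ᴴ * K k = 1) (hρ : ρ.PosSemidef) (hσ : σ.PosSemidef) {c : ℝ} (hc : 0 < c)
    (h : (σ - (c : ℂ) • ρ).PosSemidef) :
    traceMulLog (hρ.sum_kraus K).1 (∑ k, K k * ρ * (K k)ᴴ) -
        traceMulLog (hσ.sum_kraus K).1 (∑ k, K k * ρ * (K k)ᴴ) ≤
      traceMulLog hρ.1 ρ - traceMulLog hσ.1 ρ := by
  have h' : (∑ k, K k * σ * (K k)ᴴ - (c : ℂ) • ∑ k, K k * ρ * (K k)ᴴ).PosSemidef := by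
    convert h.sum_kraus K using 1
    simp [Matrix.mul_sub, Matrix.sub_mul, Finset.sum_sub_distrib, Finset.smul_sum]
  have key := sum_mul_log_sub_le_of_sum_div_le
    (eigenOverlap hρ.1 hσ.1) (fun x => hρ.1.eigenvalues x.1) (fun x => hσ.1.eigenvalues x.2)
    (eigenOverlap (hρ.sum_kraus K).1 (hσ.sum_kraus K).1)
    (fun x => (hρ.sum_kraus K).1.eigenvalues x.1) (fun x => (hσ.sum_kraus K).1.eigenvalues x.2)
    (fun x => hρ.eigenvalues_nonneg x.1) (fun x => hσ.eigenvalues_nonneg x.2)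
    (fun x => (hρ.sum_kraus K).eigenvalues_nonneg x.1)
    (fun x => (hσ.sum_kraus K).eigenvalues_nonneg x.2)
    (eigenOverlap_mul_eq_zero hρ hσ.1 hc h)
    (eigenOverlap_mul_eq_zero (hρ.sum_kraus K) (hσ.sum_kraus K).1 hc h')
    (by rw [sum_eigenOverlap_mul, sum_eigenOverlap_mul, sum_eigenvalues_eq_re_trace,
      sum_eigenvalues_eq_re_trace, trace_sum_kraus K hK])
    (fun T hT => by
      obtain ⟨Y, hY⟩ := exists_relQuad_eq (hρ.sum_kraus K) (hσ.sum_kraus K) hT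
      rw [← hY]
      exact (relQuad_sum_kraus_le K hK hρ hσ hT.le Y).trans (relQuad_le hρ hσ hT _))
  rw [← traceMulLog_eq_sum, ← traceMulLog_eq_sum] at key
  simp only [mul_assoc] at key
  rw [sum_eigenOverlap_mul hρ.1 hσ.1 (fun i => hρ.1.eigenvalues i * Real.log (hρ.1.eigenvalues i)),
    sum_eigenOverlap_mul (hρ.sum_kraus K).1 (hσ.sum_kraus K).1 (fun i =>
      (hρ.sum_kraus K).1.eigenvalues i * Real.log ((hρ.sum_kraus K).1.eigenvalues i)),
    ← traceMulLog_self, ← traceMulLog_self] at key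
  exact key

end Spectral

end Matrix

section Entropy

variable {m n ι : Type*} [Fintype m] [Fintype n] [Fintype ι] [DecidableEq m] [DecidableEq n]

theorem vnEntropy_eq_neg_traceMulLog {ρ : Matrix n n ℂ} (hρ : ρ.IsHermitian) :
    vnEntropy ρ = -traceMulLog hρ ρ / Real.log 2 := by
  rw [vnEntropy, dif_pos hρ, traceMulLog_self, neg_div, Finset.sum_div]
  simp only [Real.logb, mul_div_assoc]

/-- The Holevo quantity of a two-state ensemble does not increase under a channel. -/
theorem holevo_sum_kraus_le (K : ι → Matrix m n ℂ)
    (hK : ∑ k, (K k)ᴴ * K k = 1) {A B : Matrix n n ℂ} (hA : A.PosSemidef) (hB : B.PosSemidef)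
    {s t : ℝ} (hs : 0 < s) (ht : 0 < t) :
    vnEntropy (∑ k, K k * ((s : ℂ) • A + (t : ℂ) • B) * (K k)ᴴ) -
        s * vnEntropy (∑ k, K k * A * (K k)ᴴ) - t * vnEntropy (∑ k, K k * B * (K k)ᴴ) ≤
      vnEntropy ((s : ℂ) • A + (t : ℂ) • B) - s * vnEntropy A - t * vnEntropy B := by
  have hsA : ((s : ℂ) • A).PosSemidef := hA.smul (by exact_mod_cast hs.le)
  have htB : ((t : ℂ) • B).PosSemidef := hB.smul (by exact_mod_cast ht.le)
  have hC := hsA.add htB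
  have h1 := traceMulLog_sub_sum_kraus_le K hK hA hC hs (by simpa using htB)
  have h2 := traceMulLog_sub_sum_kraus_le K hK hB hC ht (by simpa using hsA)
  have e1 := traceMulLog_add_smul hC.1 s t A B
  have e2 := traceMulLog_add_smul (hC.sum_kraus K).1 s t
    (∑ k, K k * A * (K k)ᴴ) (∑ k, K k * B * (K k)ᴴ)
  have e3 : (s : ℂ) • ∑ k, K k * A * (K k)ᴴ + (t : ℂ) • ∑ k, K k * B * (K k)ᴴ =
      ∑ k, K k * ((s : ℂ) • A + (t : ℂ) • B) * (K k)ᴴ := by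
    simp [Matrix.mul_add, Matrix.add_mul, Finset.sum_add_distrib, Finset.smul_sum]
  rw [e3] at e2
  rw [vnEntropy_eq_neg_traceMulLog hA.1, vnEntropy_eq_neg_traceMulLog hB.1,
    vnEntropy_eq_neg_traceMulLog hC.1, vnEntropy_eq_neg_traceMulLog (hA.sum_kraus K).1,
    vnEntropy_eq_neg_traceMulLog (hB.sum_kraus K).1,
    vnEntropy_eq_neg_traceMulLog (hC.sum_kraus K).1, e1, e2]
  simp only [← mul_div_assoc, ← sub_div]
  refine div_le_div_of_nonneg_right ?_ (Real.log_pos one_lt_two).le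
  nlinarith [mul_le_mul_of_nonneg_left h1 hs.le, mul_le_mul_of_nonneg_left h2 ht.le]

end Entropy

section PartialTrace

variable {m n : Type*} [Fintype n]

theorem ptraceSnd_posSemidef {M : Matrix (m × n) (m × n) ℂ} (hM : M.PosSemidef) :
    (ptraceSnd M).PosSemidef := by
  have h : ptraceSnd M = ∑ j, M.submatrix (fun i => (i, j)) (fun i => (i, j)) := by
    ext i i'
    simp [ptraceSnd, Matrix.sum_apply]
  rw [h]
  exact Matrix.posSemidef_sum _ fun j _ => hM.submatrix _

theorem ptraceSnd_add_smul (s t : ℂ) (M N : Matrix (m × n) (m × n) ℂ) :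
    ptraceSnd (s • M + t • N) = s • ptraceSnd M + t • ptraceSnd N := by
  ext i i'
  simp [ptraceSnd, Finset.sum_add_distrib, Finset.mul_sum]

end PartialTrace

/-- Concavity of coherent information for degradable channels.  Here `V` is an
isometry from `ℂ^a` into `ℂ^b ⊗ ℂ^e`, the channel is `N(ρ) = Tr_E (V ρ Vᴴ)`, its
complement is `N_c(ρ) = Tr_B (V ρ Vᴴ)`, and degradability means `N_c = D ∘ N` for a
channel `D` given by Kraus operators `K i`.  Then
`ρ ↦ I_c(ρ,N) = H(N(ρ)) − H(N_c(ρ))` is concave on density matrices. -/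
theorem cohInfo_concave_of_degradable {a b e : ℕ}
    (V : Matrix (Fin b × Fin e) (Fin a) ℂ) (hV : Vᴴ * V = 1)
    (m : ℕ) (K : Fin m → Matrix (Fin e) (Fin b) ℂ)
    (hK : ∑ i, (K i)ᴴ * K i = 1)
    (hdeg : ∀ ρ : Matrix (Fin a) (Fin a) ℂ, ρ.PosSemidef → ρ.trace = 1 →
      ptraceFst (V * ρ * Vᴴ) = ∑ i, K i * ptraceSnd (V * ρ * Vᴴ) * (K i)ᴴ)
    (ρ₀ ρ₁ : Matrix (Fin a) (Fin a) ℂ)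
    (hρ₀ : ρ₀.PosSemidef) (hρ₀tr : ρ₀.trace = 1)
    (hρ₁ : ρ₁.PosSemidef) (hρ₁tr : ρ₁.trace = 1)
    (l : ℝ) (hl0 : 0 ≤ l) (hl1 : l ≤ 1) :
    l * (vnEntropy (ptraceSnd (V * ρ₀ * Vᴴ)) - vnEntropy (ptraceFst (V * ρ₀ * Vᴴ)))
      + (1 - l) * (vnEntropy (ptraceSnd (V * ρ₁ * Vᴴ)) - vnEntropy (ptraceFst (V * ρ₁ * Vᴴ)))
    ≤ vnEntropy (ptraceSnd (V * ((l : ℂ) • ρ₀ + ((1 - l : ℝ) : ℂ) • ρ₁) * Vᴴ))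
      - vnEntropy (ptraceFst (V * ((l : ℂ) • ρ₀ + ((1 - l : ℝ) : ℂ) • ρ₁) * Vᴴ)) := by
  rcases hl0.eq_or_lt with rfl | hl0'
  · simp
  rcases hl1.eq_or_lt with rfl | hl1'
  · simp
  have hpsd : ((l : ℂ) • ρ₀ + ((1 - l : ℝ) : ℂ) • ρ₁).PosSemidef :=
    (hρ₀.smul (by exact_mod_cast hl0)).add
      (hρ₁.smul (by exact_mod_cast sub_nonneg.2 hl1))
  have htr : ((l : ℂ) • ρ₀ + ((1 - l : ℝ) : ℂ) • ρ₁).trace = 1 := by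
    simp [hρ₀tr, hρ₁tr]
  rw [hdeg _ hpsd htr, hdeg _ hρ₀ hρ₀tr, hdeg _ hρ₁ hρ₁tr]
  have hlin : ptraceSnd (V * ((l : ℂ) • ρ₀ + ((1 - l : ℝ) : ℂ) • ρ₁) * Vᴴ) =
      (l : ℂ) • ptraceSnd (V * ρ₀ * Vᴴ) + ((1 - l : ℝ) : ℂ) • ptraceSnd (V * ρ₁ * Vᴴ) := by
    rw [← ptraceSnd_add_smul]
    simp only [Matrix.mul_add, Matrix.add_mul, Matrix.mul_smul, Matrix.smul_mul]
  rw [hlin]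
  have h := holevo_sum_kraus_le K hK
    (ptraceSnd_posSemidef (hρ₀.mul_mul_conjTranspose_same V))
    (ptraceSnd_posSemidef (hρ₁.mul_mul_conjTranspose_same V)) hl0' (sub_pos.2 hl1')
  linarith
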